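/- Let m be a positive integer that is not a power of 2, let T = 2^⌈log₂ m⌉ − m − 1, let i be a nonnegative integer, and let ε be a real number with (T+1)/2 + i·m/2 ≤ ε < (T+1)/2 + (i+1)·m/2. Set j = ⌊⌊2ε⌋/m⌋ and k = ⌊2ε⌋ mod m. Then the code-length (1 + j) + (⌊log₂ m⌋ if k ≤ T, and ⌈log₂ m⌉ if k > T) equals 2 + i + ⌊log₂ m⌋. -/

import Mathlib

/-- For a positive integer that is not a power of the base, the floor and ceiling logarithms
differ by one. -/
theorem Nat.clog_eq_log_add_one_of_not_pow {b m : ℕ} (hb : 1 < b) (hm : 0 < m)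
    (hnp : ¬ ∃ β : ℕ, m = b ^ β) : Nat.clog b m = Nat.log b m + 1 := by
  apply le_antisymm
  · exact Nat.clog_le_of_le_pow (Nat.lt_pow_succ_log_self hb m).le
  · by_contra! h
    have h1 := Nat.le_pow_clog hb m
    have h2 := Nat.pow_log_le_self b hm.ne'
    have h3 := Nat.pow_le_pow_right (by omega : 0 < b) (Nat.lt_succ_iff.mp h)
    exact hnp ⟨Nat.log b m, le_antisymm (h1.trans h3) h2⟩

/-- Lemma on code-length intervals: if `m` is not a power of 2,
`T = 2^⌈log₂ m⌉ - m - 1`, and `(T+1)/2 + i·m/2 ≤ ε < (T+1)/2 + (i+1)·m/2`, then the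
Golomb code-length of `⌊2ε⌋` with parameter `m` is `2 + i + ⌊log₂ m⌋`. -/
theorem code_length_interval (m : ℕ) (hm : 0 < m) (hnp : ¬ ∃ β : ℕ, m = 2 ^ β)
    (T : ℤ) (hT : T = 2 ^ Nat.clog 2 m - (m : ℤ) - 1)
    (i : ℕ) (ε : ℝ)
    (hlo : ((T : ℝ) + 1) / 2 + (i : ℝ) * m / 2 ≤ ε)
    (hhi : ε < ((T : ℝ) + 1) / 2 + ((i : ℝ) + 1) * m / 2)
    (j k : ℤ) (hj : j = ⌊2 * ε⌋ / (m : ℤ)) (hk : k = ⌊2 * ε⌋ % (m : ℤ)) :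
    (1 + j) + (if k ≤ T then (Nat.log 2 m : ℤ) else (Nat.clog 2 m : ℤ))
      = 2 + (i : ℤ) + (Nat.log 2 m : ℤ) := by
  have hc := Nat.clog_eq_log_add_one_of_not_pow one_lt_two hm hnp
  have hm' : (0 : ℤ) < m := by exact_mod_cast hm
  have hle : ((2 : ℤ) ^ Nat.log 2 m) ≤ m := by exact_mod_cast Nat.pow_log_le_self 2 hm.ne'
  have hlt : ((2 : ℤ) ^ Nat.log 2 m) ≠ m := fun h => hnp ⟨Nat.log 2 m, by exact_mod_cast h.symm⟩
  have hup : (m : ℤ) < 2 ^ (Nat.log 2 m + 1) := by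
    exact_mod_cast Nat.lt_pow_succ_log_self one_lt_two m
  rw [hc] at hT ⊢
  rw [pow_succ] at hT hup
  have hn1 : T + 1 + (i : ℤ) * m ≤ ⌊2 * ε⌋ := by
    rw [Int.le_floor]
    push_cast
    linarith
  have hn2 : ⌊2 * ε⌋ < T + 1 + ((i : ℤ) + 1) * m := by
    rw [Int.floor_lt]
    push_cast
    linarith
  generalize ⌊2 * ε⌋ = n at *
  have hT0 : 0 ≤ T := by omega
  have hTm : T + 1 < m := by omega
  by_cases h : n < ((i : ℤ) + 1) * m
  · obtain ⟨hji, hki⟩ := (Int.ediv_emod_unique hm' (a := n) (r := n - i * m) (q := i)).2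
      ⟨by ring, by linarith, by linarith⟩
    rw [hj, hk, hji, hki, if_neg (by linarith)]
    push_cast
    ring
  · obtain ⟨hji, hki⟩ := (Int.ediv_emod_unique hm' (a := n) (r := n - (i + 1) * m) (q := i + 1)).2
      ⟨by ring, by linarith, by linarith⟩
    rw [hj, hk, hji, hki, if_pos (by linarith)]
    ring
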